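/- arXiv:2211.16758 — 9 statements merged into one kernel-verified Lean document; each statement's English description precedes it below -/
import Mathlib

section
/- Let n ∈ ℕ and let V be a finite subset of {0, 1, …, n−1} that is admissible. Then the cardinality of V is at most ⌊(n+3)/2⌋. -/
/-- A finite set `V ⊆ {0, 1, …, n−1}` is *admissible* if every pair of consecutive
elements of `V` has no element of `V` strictly to its left or no element of `V`
strictly to its right. -/
def Admissible (n : ℕ) (V : Finset ℕ) : Prop :=
  V ⊆ Finset.range n ∧
  ∀ i : ℕ, i ∈ V → i + 1 ∈ V → (∀ j ∈ V, i ≤ j) ∨ (∀ j ∈ V, j ≤ i + 1)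

/-- A set of natural numbers in `[a, b)` with no two consecutive elements, and not containing `b - 1`,
fills at most half of the interval. -/
theorem two_mul_card_le_of_forall_succ_notMem {W : Finset ℕ} {a b : ℕ}
    (hW : ∀ i ∈ W, a ≤ i ∧ i + 1 < b) (hsucc : ∀ i ∈ W, i + 1 ∉ W) :
    2 * W.card ≤ b - a := by
  have hdisj : Disjoint W (W.image (· + 1)) := by
    rw [Finset.disjoint_right]
    intro x hx
    obtain ⟨i, hi, rfl⟩ := Finset.mem_image.mp hx
    exact hsucc i hi
  have hsub : W ∪ W.image (· + 1) ⊆ Finset.Ico a b := by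
    intro x hx
    rw [Finset.mem_Ico]
    rcases Finset.mem_union.mp hx with hx | hx
    · have := hW x hx
      omega
    · obtain ⟨i, hi, rfl⟩ := Finset.mem_image.mp hx
      have := hW i hi
      omega
  have hcard := Finset.card_le_card hsub
  rw [Finset.card_union_of_disjoint hdisj,
    Finset.card_image_of_injective _ (add_left_injective 1), Nat.card_Ico] at hcard
  omega

/-- **Theorem 1 (combinatorial form).** Any admissible subset of `{0, …, n−1}` has
cardinality at most `⌊(n+3)/2⌋`. -/
theorem admissible_card_le (n : ℕ) (V : Finset ℕ) (hV : Admissible n V) :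
    V.card ≤ (n + 3) / 2 := by
  obtain ⟨hsub, hadm⟩ := hV
  rcases V.eq_empty_or_nonempty with rfl | hne
  · simp
  have hmin := V.min'_mem hne
  have hmax := V.max'_mem hne
  have hmaxlt := Finset.mem_range.mp (hsub hmax)
  have hle := V.min'_le
  have hge := V.le_max'
  set m := V.min' hne
  set M := V.max' hne
  have hmem : ∀ i ∈ (V.erase m).erase M, i ∈ V ∧ m < i ∧ i < M := by
    intro i hi
    obtain ⟨hiM, him, hiV⟩ : i ≠ M ∧ i ≠ m ∧ i ∈ V := by simpa using hi
    exact ⟨hiV, lt_of_le_of_ne (hle i hiV) him.symm, lt_of_le_of_ne (hge i hiV) hiM⟩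
  have hcard : 2 * ((V.erase m).erase M).card ≤ n - 1 := by
    refine two_mul_card_le_of_forall_succ_notMem (fun i hi => ?_) (fun i hi hi' => ?_)
    · have := hmem i hi
      omega
    · have h := hmem i hi
      have h' := hmem (i + 1) hi'
      rcases hadm i h.1 h'.1 with hl | hr
      · have := hl m hmin
        omega
      · have := hr M hmax
        omega
  have h₁ := Finset.pred_card_le_card_erase (s := V) (a := m)
  have h₂ := Finset.pred_card_le_card_erase (s := V.erase m) (a := M)
  omega
end

section
/- For every natural number n ≥ 2 there exists an admissible set V ⊆ {0, 1, …, n−1} with cardinality exactly ⌊(n+3)/2⌋; hence the bound ⌊(n+3)/2⌋ on the size of admissible sets is tight for every n ≥ 2. -/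
/-- **Tightness of the bound.** For every `n ≥ 2` there exists an admissible subset of
`{0, …, n−1}` of cardinality exactly `⌊(n+3)/2⌋`. -/
theorem exists_admissible_card_eq (n : ℕ) (hn : 2 ≤ n) :
    ∃ V : Finset ℕ, Admissible n V ∧ V.card = (n + 3) / 2 := by
  obtain rfl | hn3 := hn.eq_or_lt
  · refine ⟨{0, 1}, ⟨by decide, fun i hi _ => Or.inr fun j hj => ?_⟩, rfl⟩
    simp only [Finset.mem_insert, Finset.mem_singleton] at hi hj
    omega
  · obtain ⟨k, hk⟩ : ∃ k, k = (n - 1) / 2 := ⟨_, rfl⟩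
    refine ⟨insert 0 (insert (2 * k) ((Finset.range k).image fun i => 2 * i + 1)), ⟨?_, ?_⟩, ?_⟩
    · intro x hx
      simp only [Finset.mem_insert, Finset.mem_image, Finset.mem_range] at hx ⊢
      omega
    · intro i hi hi'
      simp only [Finset.mem_insert, Finset.mem_image, Finset.mem_range] at hi hi' ⊢
      obtain rfl | hi0 := Nat.eq_zero_or_pos i
      · exact Or.inl fun j _ => j.zero_le
      · refine Or.inr fun j hj => ?_
        obtain hi | hi | ⟨a, _, rfl⟩ := hi <;> obtain hi' | hi' | ⟨b, _, hi'⟩ := hi' <;>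
          obtain hj | hj | ⟨c, _, rfl⟩ := hj <;> omega
    · rw [Finset.card_insert_of_notMem, Finset.card_insert_of_notMem,
        Finset.card_image_of_injective, Finset.card_range]
      · omega
      · intro a b hab
        simp only at hab
        omega
      · simp only [Finset.mem_image, Finset.mem_range]
        omega
      · simp only [Finset.mem_insert, Finset.mem_image, Finset.mem_range]
        omega
end

section
/- Let n ≥ 5 be odd. Then the set V = {0, 1, n−2, n−1} ∪ {k : k odd, 3 ≤ k ≤ n−4} is an admissible subset of {0, 1, …, n−1} and has cardinality exactly (n+3)/2. -/
/-- For `n = 2m + 1`, the pattern consists of both endpoints and all odd positions. -/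
theorem maximal_pattern_eq_insert_image (m : ℕ) (hm : 2 ≤ m) :
    ({0, 1, 2 * m + 1 - 2, 2 * m + 1 - 1} : Finset ℕ) ∪
      (Finset.range (2 * m + 1)).filter (fun k => Odd k ∧ 3 ≤ k ∧ k ≤ 2 * m + 1 - 4) =
    insert 0 (insert (2 * m) ((Finset.range m).image (fun k => 2 * k + 1))) := by
  ext x
  simp only [Finset.mem_union, Finset.mem_insert, Finset.mem_singleton, Finset.mem_filter,
    Finset.mem_range, Finset.mem_image, Nat.odd_iff]
  constructor
  · intro h
    by_cases hx : x % 2 = 1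
    · exact Or.inr (Or.inr ⟨x / 2, by omega, by omega⟩)
    · omega
  · rintro (h | h | ⟨k, hk, rfl⟩) <;> omega

/-- **The maximal pattern for odd `n`.** For odd `n ≥ 5`, the set
`V = {0, 1, n−2, n−1} ∪ {k : k odd, 3 ≤ k ≤ n−4}` is admissible and has cardinality
exactly `(n+3)/2`. -/
theorem maximal_pattern_odd (n : ℕ) (hn : 5 ≤ n) (hodd : Odd n) :
    Admissible n (({0, 1, n - 2, n - 1} : Finset ℕ) ∪
      (Finset.range n).filter (fun k => Odd k ∧ 3 ≤ k ∧ k ≤ n - 4)) ∧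
    (({0, 1, n - 2, n - 1} : Finset ℕ) ∪
      (Finset.range n).filter (fun k => Odd k ∧ 3 ≤ k ∧ k ≤ n - 4)).card = (n + 3) / 2 := by
  obtain ⟨m, rfl⟩ := hodd
  rw [maximal_pattern_eq_insert_image m (by omega)]
  refine ⟨⟨fun x hx => ?_, fun i hi hi' => ?_⟩, ?_⟩
  · simp only [Finset.mem_insert, Finset.mem_image, Finset.mem_range] at hx ⊢
    rcases hx with h | h | ⟨k, hk, rfl⟩ <;> omega
  · simp only [Finset.mem_insert, Finset.mem_image, Finset.mem_range] at hi hi' ⊢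
    obtain h | h : i = 0 ∨ i + 1 = 2 * m := by
      rcases hi with h | h | ⟨k, hk, rfl⟩ <;> rcases hi' with h' | h' | ⟨l, hl, hl'⟩ <;> omega
    · left
      intro j _
      omega
    · right
      rintro j (hj | hj | ⟨k, hk, rfl⟩) <;> omega
  · rw [Finset.card_insert_of_notMem, Finset.card_insert_of_notMem,
      Finset.card_image_of_injective _ (fun a b h => by simpa using h), Finset.card_range]
    · omega
    · simp only [Finset.mem_image, not_exists, not_and]
      intro k _
      omega
    · simp only [Finset.mem_insert, Finset.mem_image, not_or, not_exists, not_and]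
      exact ⟨by omega, fun k _ => by omega⟩
end

section
/- Let n ∈ ℕ and let V ⊆ {0, 1, …, n−1} be admissible. If there exists i with i ∈ V, i+1 ∈ V and i+2 ∈ V (a 3-island), then V = {i, i+1, i+2}; in particular the cardinality of V equals 3. -/
/-- **Corollary 1.** If an admissible set contains a `3`-island `i, i+1, i+2`, then it
equals `{i, i+1, i+2}`; in particular its cardinality is `3`. -/
theorem admissible_three_island (n : ℕ) (V : Finset ℕ) (hV : Admissible n V)
    (i : ℕ) (h0 : i ∈ V) (h1 : i + 1 ∈ V) (h2 : i + 2 ∈ V) :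
    V = {i, i + 1, i + 2} ∧ V.card = 3 := by
  have hmin : ∀ j ∈ V, i ≤ j := by
    rcases hV.2 i h0 h1 with h | h
    · exact h
    · have := h _ h2
      omega
  have hmax : ∀ j ∈ V, j ≤ i + 2 := by
    rcases hV.2 (i + 1) h1 h2 with h | h
    · have := h _ h0
      omega
    · exact h
  have hEq : V = {i, i + 1, i + 2} := by
    ext j
    simp only [Finset.mem_insert, Finset.mem_singleton]
    constructor
    · intro hj
      have := hmin j hj
      have := hmax j hj
      omega
    · rintro (rfl | rfl | rfl) <;> assumption
  refine ⟨hEq, ?_⟩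
  rw [hEq]
  exact Finset.card_eq_three.mpr ⟨i, i + 1, i + 2, by omega, by omega, by omega, rfl⟩
end

section
/- Let n ≥ 3 and let V be a subset of ℤ/nℤ such that there is at most one element i ∈ ℤ/nℤ with both i ∈ V and i+1 ∈ V. Then the cardinality of V is at most ⌊(n+1)/2⌋. -/
/-- **Ring graph variant.** If `V ⊆ ℤ/nℤ` (vertices of a cycle on `n ≥ 3` vertices)
contains at most one element `i` with both `i ∈ V` and `i+1 ∈ V`, then
`|V| ≤ ⌊(n+1)/2⌋`. -/
theorem ring_card_le (n : ℕ) (hn : 3 ≤ n) (V : Finset (ZMod n))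
    (h : (V.filter (fun i => i + 1 ∈ V)).card ≤ 1) :
    V.card ≤ (n + 1) / 2 := by
  have : NeZero n := ⟨by omega⟩
  have hsplit := V.card_filter_add_card_filter_not (fun i => i + 1 ∈ V)
  have hshift : (V.filter (fun i => ¬ i + 1 ∈ V)).card ≤ Vᶜ.card := by
    refine Finset.card_le_card_of_injOn (fun i => i + 1) (fun i hi => ?_)
      (add_left_injective 1).injOn
    simpa using (Finset.mem_filter.mp hi).2
  have hcompl := V.card_add_card_compl
  rw [ZMod.card] at hcompl
  omega
end

section
/- Let n ≥ 5 be odd, set m = (n+3)/2, let M = {k : k even, 2 ≤ k ≤ n−3} ⊆ {0,…,n−1} and let V = {0,…,n−1} \ M, so |V| = m. Assign the basis b(j) = x to every j ∈ M. Then for every outcome string s : M → Fin 2 and every choice of unit eigenvectors χ_j of σ_x with eigenvalue (−1)^{s(j)}, there exist 2×2 complex matrices U_0, …, U_{m−1}, each a finite product of matrices from {H, σ_x, σ_z} where H is the Hadamard matrix (1/√2)·!![1,1;1,−1], and a scalar c ∈ ℂ with c ≠ 0 and |c| = (√2)^{−(n−m)}, such that (⨂_i U_i) φ = c · GHZ_m,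 where φ is the post-measurement state determined by M, b, s and the χ_j. -/
noncomputable section

/-- The `j`-th bit of a bit string `v : Fin k → Fin 2`, with out-of-range indices
giving `0`. -/
def bitAt (k : ℕ) (v : Fin k → Fin 2) (j : ℕ) : Fin 2 :=
  if h : j < k then v ⟨j, h⟩ else 0

/-- The `n`-qubit linear cluster state:
`L_n(v) = (√2)^{−n} · (−1)^{Σ_{i=0}^{n−2} v_i·v_{i+1}}`. -/
def linCluster (n : ℕ) : (Fin n → Fin 2) → ℂ := fun v =>
  ((Real.sqrt 2 : ℂ))⁻¹ ^ n *
    (-1 : ℂ) ^ (∑ i ∈ Finset.range (n - 1), (bitAt n v i : ℕ) * (bitAt n v (i + 1) : ℕ))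

/-- The `m`-qubit GHZ state: `GHZ_m(w) = (√2)^{−1}` if `w` is constant, `0` otherwise. -/
def ghzState (m : ℕ) : (Fin m → Fin 2) → ℂ := fun w =>
  if ∀ i j : Fin m, w i = w j then ((Real.sqrt 2 : ℂ))⁻¹ else 0

/-- The Pauli matrix `σ_x`. -/
def sigmaX : Matrix (Fin 2) (Fin 2) ℂ := !![0, 1; 1, 0]

/-- The Pauli matrix `σ_y`. -/
def sigmaY : Matrix (Fin 2) (Fin 2) ℂ := !![0, -Complex.I; Complex.I, 0]

/-- The Pauli matrix `σ_z`. -/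
def sigmaZ : Matrix (Fin 2) (Fin 2) ℂ := !![1, 0; 0, -1]

/-- The Hadamard matrix `(1/√2)·!![1,1;1,−1]`. -/
def hadamard : Matrix (Fin 2) (Fin 2) ℂ := ((Real.sqrt 2 : ℂ))⁻¹ • !![1, 1; 1, -1]

/-- A measurement basis label: `x`, `y` or `z`. -/
inductive PauliBasis | x | y | z

/-- The Pauli matrix corresponding to a basis label. -/
def pauliOf : PauliBasis → Matrix (Fin 2) (Fin 2) ℂ
  | .x => sigmaX
  | .y => sigmaY
  | .z => sigmaZ

/-- The (unnormalized) post-measurement state on the unmeasured qubits: for a target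
bit string `w : Fin m → Fin 2`,
`φ(w) = Σ_{v : Fin n → Fin 2, v ∘ ι = w} (∏_{j∈M} conj(χ_j(v(j)))) · L_n(v)`,
where `ι` is the enumeration of the unmeasured qubits and `χ_j` the post-measurement
single-qubit states on the measured qubits `j ∈ M`. -/
def postMeas (n m : ℕ) (M : Finset ℕ) (ι : Fin m → ℕ) (χ : ℕ → Fin 2 → ℂ) :
    (Fin m → Fin 2) → ℂ := fun w =>
  ∑ v ∈ Finset.univ.filter (fun v : Fin n → Fin 2 => ∀ i : Fin m, bitAt n v (ι i) = w i),
    (∏ j ∈ M, (starRingEnd ℂ) (χ j (bitAt n v j))) * linCluster n v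

/-- The action of a tensor product `⨂_i U_i` of single-qubit operators on an `m`-qubit
state vector: `((⨂_i U_i)ψ)(w) = Σ_{w'} (∏_i U_i(w(i), w'(i))) · ψ(w')`. -/
def localApply (m : ℕ) (U : Fin m → Matrix (Fin 2) (Fin 2) ℂ)
    (ψ : (Fin m → Fin 2) → ℂ) : (Fin m → Fin 2) → ℂ := fun w =>
  ∑ w' : Fin m → Fin 2, (∏ i : Fin m, U i (w i) (w' i)) * ψ w'

/-- A `2×2` matrix is a Clifford unitary if it is unitary and conjugates each of
`σ_x, σ_z` into `{±1, ±i} · {1, σ_x, σ_y, σ_z}`. -/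
def IsClifford (U : Matrix (Fin 2) (Fin 2) ℂ) : Prop :=
  U ∈ Matrix.unitaryGroup (Fin 2) ℂ ∧
  ∀ P ∈ ({sigmaX, sigmaZ} : Set (Matrix (Fin 2) (Fin 2) ℂ)),
    ∃ c ∈ ({1, -1, Complex.I, -Complex.I} : Set ℂ),
      ∃ Q ∈ ({1, sigmaX, sigmaY, sigmaZ} : Set (Matrix (Fin 2) (Fin 2) ℂ)),
        U * P * U⁻¹ = c • Q

lemma bitAt_of_lt {k : ℕ} (v : Fin k → Fin 2) {j : ℕ} (h : j < k) : bitAt k v j = v ⟨j, h⟩ :=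
  dif_pos h

lemma bitAt_fin {k : ℕ} (v : Fin k → Fin 2) (j : Fin k) : bitAt k v j = v j :=
  bitAt_of_lt v j.2

/-- The position of the `i`-th unmeasured qubit in the cluster of `2 * p + 3` qubits. -/
def survivor (p i : ℕ) : ℕ := min (2 * i - 1) (2 * p + 2)

lemma sum_range_pair_odd {A : Type*} [AddCommMonoid A] (f : ℕ → A) (p : ℕ) :
    ∑ i ∈ Finset.range (2 * p + 2), f i =
      f 0 + ∑ k ∈ Finset.range p, (f (2 * k + 1) + f (2 * k + 2)) + f (2 * p + 1) := by
  rw [Finset.sum_range_succ]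
  congr 1
  induction p with
  | zero => simp
  | succ p ih =>
    rw [show 2 * (p + 1) + 1 = (2 * p + 1) + 1 + 1 by ring, Finset.sum_range_succ,
      Finset.sum_range_succ, ih, Finset.sum_range_succ]
    simp only [add_assoc]

lemma linCluster_odd (p : ℕ) (v : Fin (2 * p + 3) → Fin 2) (x : ℕ → Fin 2)
    (hx : ∀ j, bitAt (2 * p + 3) v j = x j) :
    linCluster (2 * p + 3) v = ((Real.sqrt 2 : ℂ))⁻¹ ^ (2 * p + 3) *
      ((-1) ^ ((x 0 : ℕ) * x 1) * (-1) ^ ((x (2 * p + 1) : ℕ) * x (2 * p + 2)) *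
        ∏ k ∈ Finset.range p,
          (-1) ^ ((x (2 * k + 2) : ℕ) * ((x (2 * k + 1) : ℕ) + x (2 * k + 3)))) := by
  unfold linCluster
  congr 1
  simp only [hx]
  rw [show 2 * p + 3 - 1 = 2 * p + 2 by omega, sum_range_pair_odd, pow_add, pow_add, mul_right_comm]
  congr 1
  rw [Finset.prod_pow_eq_pow_sum]
  congr 1
  refine Finset.sum_congr rfl fun k _ => ?_
  ring

/-- Summing a product over the bits outside the image of `ι` factorizes. -/
lemma sum_filter_bits_prod {n m p : ℕ} (ι : Fin m → Fin n) (κ : Fin p → Fin n)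
    (h : Function.Bijective (Sum.elim ι κ)) (w : Fin m → Fin 2) (g : Fin p → Fin 2 → ℂ) :
    ∑ v ∈ Finset.univ.filter (fun v : Fin n → Fin 2 => ∀ i, v (ι i) = w i), ∏ k, g k (v (κ k)) =
      ∏ k, ∑ a, g k a := by
  rw [Fintype.prod_sum, Finset.sum_filter]
  let e : (Fin n → Fin 2) ≃ (Fin m → Fin 2) × (Fin p → Fin 2) :=
    ((Equiv.ofBijective _ h).symm.arrowCongr (Equiv.refl _)).trans
      (Equiv.sumArrowEquivProdArrow _ _ _)
  have h1 : ∀ v i, (e v).1 i = v (ι i) := fun v i => rfl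
  have h2 : ∀ v k, (e v).2 k = v (κ k) := fun v k => rfl
  simp only [← h1, ← h2, ← funext_iff]
  rw [e.sum_comp (fun y => if y.1 = w then ∏ k, g k (y.2 k) else 0), Fintype.sum_prod_type,
    Finset.sum_comm]
  simp

lemma survivor_measured_bijective (p : ℕ) :
    Function.Bijective (Sum.elim
      (fun i : Fin (p + 3) => (⟨survivor p i, by unfold survivor; omega⟩ : Fin (2 * p + 3)))
      (fun k : Fin p => (⟨2 * k + 2, by omega⟩ : Fin (2 * p + 3)))) := by
  rw [Fintype.bijective_iff_injective_and_card]
  constructor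
  · rintro (i | i) (j | j) h <;> simp [survivor, Fin.ext_iff] at h ⊢ <;> omega
  · simp; ring

lemma postMeas_odd (p : ℕ) (χ : ℕ → Fin 2 → ℂ) (w : Fin (p + 3) → Fin 2) (y : ℕ → Fin 2)
    (hy : ∀ j, bitAt (p + 3) w j = y j) :
    postMeas (2 * p + 3) (p + 3) ((Finset.range p).image (fun k => 2 * k + 2))
      (fun i => survivor p i) χ w =
    ((Real.sqrt 2 : ℂ))⁻¹ ^ (2 * p + 3) *
      ((-1) ^ ((y 0 : ℕ) * y 1) * (-1) ^ ((y (p + 1) : ℕ) * y (p + 2))) *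
        ∏ k ∈ Finset.range p, ∑ a : Fin 2, (starRingEnd ℂ) (χ (2 * k + 2) a) *
          (-1) ^ ((a : ℕ) * ((y (k + 1) : ℕ) + y (k + 2))) := by
  unfold postMeas
  rw [Finset.prod_range (fun k => ∑ a : Fin 2, (starRingEnd ℂ) (χ (2 * k + 2) a) *
          (-1) ^ ((a : ℕ) * ((y (k + 1) : ℕ) + y (k + 2)))),
    ← sum_filter_bits_prod _ _ (survivor_measured_bijective p) w, Finset.mul_sum]
  have hs : ∀ i : Fin (p + 3), survivor p i < 2 * p + 3 := fun i => by unfold survivor; omega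
  refine Finset.sum_congr ?_ fun v hv => ?_
  · ext v
    simp only [Finset.mem_filter, bitAt_of_lt v (hs _)]
  have hv' : ∀ i : ℕ, i < p + 3 → bitAt (2 * p + 3) v (survivor p i) = y i := fun i hi => by
    rw [bitAt_of_lt v (hs ⟨i, hi⟩), ← hy, bitAt_of_lt w hi]
    exact (Finset.mem_filter.1 hv).2 ⟨i, hi⟩
  have h0 : bitAt (2 * p + 3) v 0 = y 0 := by simpa [survivor] using hv' 0 (by omega)
  have hodd : ∀ k ≤ p, bitAt (2 * p + 3) v (2 * k + 1) = y (k + 1) := fun k hk => by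
    rw [← hv' (k + 1) (by omega)]
    congr 1
    unfold survivor
    omega
  have hlast : bitAt (2 * p + 3) v (2 * p + 2) = y (p + 2) := by
    rw [← hv' (p + 2) (by omega)]
    congr 1
    unfold survivor
    omega
  have hone : bitAt (2 * p + 3) v 1 = y 1 := hodd 0 (Nat.zero_le p)
  rw [linCluster_odd p v _ (fun _ => rfl), Finset.prod_image (fun a _ b _ h => by simpa using h),
    h0, hone, hodd p le_rfl, hlast, Finset.prod_mul_distrib, Finset.prod_range, Finset.prod_range]
  have hodd' : ∀ k : Fin p, bitAt (2 * p + 3) v (2 * k + 1) = y (k + 1) ∧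
      bitAt (2 * p + 3) v (2 * k + 3) = y (k + 2) := fun k =>
    ⟨hodd k (by omega), hodd (k + 1) (by omega)⟩
  have hmid : ∀ k : Fin p, bitAt (2 * p + 3) v (2 * k + 2) = v ⟨2 * k + 2, by omega⟩ := fun k =>
    bitAt_of_lt v (by omega)
  simp only [hodd', hmid]
  ring

lemma eigenvector_sigmaX {χ : Fin 2 → ℂ} {s : Fin 2}
    (h : sigmaX.mulVec χ = ((-1 : ℂ) ^ (s : ℕ)) • χ) :
    χ 1 = (-1) ^ (s : ℕ) * χ 0 := by
  simpa [sigmaX, Matrix.mulVec, dotProduct, Fin.sum_univ_two] using congrFun h 0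

lemma norm_eigenvector_sigmaX {χ : Fin 2 → ℂ} {s : Fin 2} (h : χ 1 = (-1) ^ (s : ℕ) * χ 0)
    (hu : ∑ a : Fin 2, ‖χ a‖ ^ 2 = 1) : ‖χ 0‖ = (Real.sqrt 2)⁻¹ := by
  have h1 : ‖χ 1‖ = ‖χ 0‖ := by simp [h]
  rw [Fin.sum_univ_two, h1] at hu
  rw [← Real.sqrt_inv, eq_comm, Real.sqrt_eq_iff_eq_sq (by norm_num) (norm_nonneg _)]
  linarith

lemma sum_eigenvector_sigmaX {χ : Fin 2 → ℂ} {s : Fin 2} (h : χ 1 = (-1) ^ (s : ℕ) * χ 0)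
    (x y : Fin 2) :
    ∑ a : Fin 2, (starRingEnd ℂ) (χ a) * (-1) ^ ((a : ℕ) * ((x : ℕ) + y)) =
      (starRingEnd ℂ) (χ 0) * 2 * if y = x + s then 1 else 0 := by
  rw [Fin.sum_univ_two, h]
  fin_cases s <;> fin_cases x <;> fin_cases y <;> simp [mul_two]

/-- The parity of the first `k` outcomes, with qubit `2 * j + 2` giving the `j`-th one. -/
def outcomeParity (s : ℕ → Fin 2) (k : ℕ) : Fin 2 := ∑ j ∈ Finset.range k, s (2 * j + 2)

lemma outcomeParity_succ (s : ℕ → Fin 2) (k : ℕ) :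
    outcomeParity s (k + 1) = outcomeParity s k + s (2 * k + 2) :=
  Finset.sum_range_succ _ _

lemma prod_chain_indicator (s : ℕ → Fin 2) (y : ℕ → Fin 2) (p : ℕ) :
    (∏ k ∈ Finset.range p, if y (k + 1) = y k + s (2 * k + 2) then (1 : ℂ) else 0) =
      ∏ k ∈ Finset.range (p + 1), if y k = y 0 + outcomeParity s k then (1 : ℂ) else 0 := by
  induction p with
  | zero => simp [outcomeParity]
  | succ p ih =>
    rw [Finset.prod_range_succ, ih, Finset.prod_range_succ _ (p + 1),
      Finset.prod_range_succ _ p, mul_assoc, mul_assoc]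
    congr 1
    by_cases h : y p = y 0 + outcomeParity s p
    · simp [h, outcomeParity_succ, add_assoc]
    · simp [h]

/-- The local amplitude at site `i` of the branch `a` of the post-measurement state. -/
def branch (p : ℕ) (s : ℕ → Fin 2) (a : Fin 2) (i : ℕ) (b : Fin 2) : ℂ :=
  if i = 0 ∨ i = p + 2 then (-1) ^ ((b : ℕ) * (a + outcomeParity s (min (i - 1) p) : Fin 2))
  else if b = a + outcomeParity s (min (i - 1) p) then 1 else 0

/-- The local correction at site `i`. -/
def correction (p : ℕ) (s : ℕ → Fin 2) (i : ℕ) : Matrix (Fin 2) (Fin 2) ℂ :=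
  if i = 0 ∨ i = p + 2 then
    hadamard * sigmaZ ^ (outcomeParity s (min (i - 1) p) : ℕ)
  else sigmaX ^ (outcomeParity s (min (i - 1) p) : ℕ)

lemma correction_eq_list_prod (p : ℕ) (s : ℕ → Fin 2) (i : ℕ) :
    ∃ L : List (Matrix (Fin 2) (Fin 2) ℂ),
      (∀ A ∈ L, A ∈ ({hadamard, sigmaX, sigmaZ} : Set (Matrix (Fin 2) (Fin 2) ℂ))) ∧
      correction p s i = L.prod := by
  unfold correction
  split_ifs
  · refine ⟨hadamard :: List.replicate _ sigmaZ, fun A hA => ?_, by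
      rw [List.prod_cons, List.prod_replicate]⟩
    rcases List.mem_cons.1 hA with rfl | hA
    · simp
    · simp [List.eq_of_mem_replicate hA]
  · exact ⟨List.replicate _ sigmaX,
      fun A hA => Or.inr (Or.inl (List.eq_of_mem_replicate hA)), by rw [List.prod_replicate]⟩

lemma inv_sqrt_two_add : ((Real.sqrt 2 : ℂ))⁻¹ + ((Real.sqrt 2 : ℂ))⁻¹ = (Real.sqrt 2 : ℂ) := by
  have h : (Real.sqrt 2 : ℂ) ^ 2 = 2 := by norm_cast; exact Real.sq_sqrt (by norm_num)
  have h0 : (Real.sqrt 2 : ℂ) ≠ 0 := by simp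
  field_simp
  rw [h]
  norm_num

lemma correction_mul_branch (p : ℕ) (s : ℕ → Fin 2) (a : Fin 2) (i : ℕ) (c : Fin 2) :
    ∑ b : Fin 2, correction p s i c b * branch p s a i b =
      if i = 0 ∨ i = p + 2 then if c = a then (Real.sqrt 2 : ℂ) else 0
      else if c = a then 1 else 0 := by
  unfold correction branch
  generalize outcomeParity s (min (i - 1) p) = t
  have h2 := inv_sqrt_two_add
  split_ifs with h hc hc
  all_goals
    fin_cases t <;> fin_cases a <;> fin_cases c <;>
      simp_all [hadamard, sigmaX, sigmaZ, Fin.sum_univ_two, Matrix.mul_apply]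

lemma localApply_sum_prod {m : ℕ} (U : Fin m → Matrix (Fin 2) (Fin 2) ℂ) (K : ℂ)
    (h : Fin 2 → Fin m → Fin 2 → ℂ) (w : Fin m → Fin 2) :
    localApply m U (fun w => K * ∑ a, ∏ i, h a i (w i)) w =
      K * ∑ a, ∏ i, ∑ b, U i (w i) b * h a i b := by
  unfold localApply
  simp only [Fintype.prod_sum, Finset.mul_sum, Finset.prod_mul_distrib]
  rw [Finset.sum_comm]
  exact Finset.sum_congr rfl fun a _ => Finset.sum_congr rfl fun x _ => mul_left_comm _ _ _

lemma ghzState_eq_sum_prod (m : ℕ) (w : Fin (m + 1) → Fin 2) :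
    ghzState (m + 1) w =
      ((Real.sqrt 2 : ℂ))⁻¹ * ∑ a : Fin 2, ∏ i, if w i = a then (1 : ℂ) else 0 := by
  unfold ghzState
  simp only [Finset.prod_ite_zero, Finset.mem_univ, true_imp_iff, Finset.prod_const_one]
  rw [Finset.sum_eq_single (w 0)]
  · by_cases h : ∀ i, w i = w 0
    · rw [if_pos h, if_pos fun i j => (h i).trans (h j).symm, mul_one]
    · rw [if_neg h, if_neg fun h' => h fun i => h' i 0, mul_zero]
  · exact fun b _ hb => if_neg fun h => hb (h 0).symm
  · simp

/-- A product over `Fin (p + 3)` splits into the two end sites and the interior. -/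
lemma prod_fin_ends {A : Type*} [CommMonoid A] (p : ℕ) (f : ℕ → A) :
    ∏ i : Fin (p + 3), f i = f 0 * f (p + 2) * ∏ k ∈ Finset.range (p + 1), f (k + 1) := by
  rw [← Finset.prod_range, Finset.prod_range_succ, Finset.prod_range_succ', mul_comm, ← mul_assoc,
    mul_right_comm, mul_comm (f (p + 2))]

lemma postMeas_odd_eq_branches (p : ℕ) (s : ℕ → Fin 2) (χ : ℕ → Fin 2 → ℂ)
    (hχ : ∀ k < p, χ (2 * k + 2) 1 = (-1) ^ (s (2 * k + 2) : ℕ) * χ (2 * k + 2) 0) :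
    postMeas (2 * p + 3) (p + 3) ((Finset.range p).image (fun k => 2 * k + 2))
      (fun i => survivor p i) χ = fun w =>
    (((Real.sqrt 2 : ℂ))⁻¹ ^ (2 * p + 3) * 2 ^ p *
      ∏ k ∈ Finset.range p, (starRingEnd ℂ) (χ (2 * k + 2) 0)) *
        ∑ a : Fin 2, ∏ i : Fin (p + 3), branch p s a i (w i) := by
  funext w
  rw [postMeas_odd p χ w _ (fun _ => rfl)]
  set y := bitAt (p + 3) w with hy
  have hb : ∀ a, ∏ i : Fin (p + 3), branch p s a i (w i) =
      ((-1) ^ ((y 0 : ℕ) * a) * (-1) ^ ((y (p + 2) : ℕ) * (a + outcomeParity s p : Fin 2))) *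
        ∏ k ∈ Finset.range (p + 1), if y (k + 1) = a + outcomeParity s k then (1 : ℂ) else 0 := by
    intro a
    simp only [← bitAt_fin w, ← hy]
    rw [prod_fin_ends p (fun i => branch p s a i (y i))]
    congr 1
    · simp [branch, outcomeParity]
    · refine Finset.prod_congr rfl fun k hk => ?_
      have hk := Finset.mem_range.1 hk
      rw [branch, if_neg (by omega), show min (k + 1 - 1) p = k by omega]
  have hp : ∏ k ∈ Finset.range p, ∑ a : Fin 2, (starRingEnd ℂ) (χ (2 * k + 2) a) *
        (-1) ^ ((a : ℕ) * ((y (k + 1) : ℕ) + y (k + 2))) =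
      (∏ k ∈ Finset.range p, (starRingEnd ℂ) (χ (2 * k + 2) 0)) * 2 ^ p *
        ∏ k ∈ Finset.range (p + 1),
          if y (k + 1) = y 1 + outcomeParity s k then (1 : ℂ) else 0 := by
    rw [← prod_chain_indicator s (fun k => y (k + 1)) p,
      Finset.prod_congr rfl fun k hk => sum_eigenvector_sigmaX (hχ k (Finset.mem_range.1 hk)) _ _,
      Finset.prod_mul_distrib, Finset.prod_mul_distrib]
    simp
  rw [Finset.sum_eq_single (y 1), hb, hp]
  · by_cases h : y (p + 1) = y 1 + outcomeParity s p
    · rw [← h, mul_comm (y (p + 2) : ℕ)]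
      ring
    · simp [Finset.prod_range_succ, h]
  · intro a _ ha
    rw [hb, Finset.prod_range_succ']
    simp [outcomeParity, ha.symm]
  · simp

lemma localApply_correction_postMeas (p : ℕ) (s : ℕ → Fin 2) (χ : ℕ → Fin 2 → ℂ)
    (hχ : ∀ k < p, χ (2 * k + 2) 1 = (-1) ^ (s (2 * k + 2) : ℕ) * χ (2 * k + 2) 0) :
    localApply (p + 3) (fun i => correction p s i)
      (postMeas (2 * p + 3) (p + 3) ((Finset.range p).image (fun k => 2 * k + 2))
        (fun i => survivor p i) χ) =
      (∏ k ∈ Finset.range p, (starRingEnd ℂ) (χ (2 * k + 2) 0)) • ghzState (p + 3) := by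
  rw [postMeas_odd_eq_branches p s χ hχ]
  funext w
  rw [localApply_sum_prod _ _ (fun a i b => branch p s a i b), Pi.smul_apply,
    ghzState_eq_sum_prod, smul_eq_mul]
  have hprod : ∀ a : Fin 2,
      (∏ i : Fin (p + 3), ∑ b : Fin 2, correction p s i (w i) b * branch p s a i b) =
        2 * ∏ i : Fin (p + 3), if w i = a then (1 : ℂ) else 0 := by
    intro a
    simp only [correction_mul_branch, ← bitAt_fin w]
    rw [prod_fin_ends p (fun i => if i = 0 ∨ i = p + 2 then
        if bitAt (p + 3) w i = a then (Real.sqrt 2 : ℂ) else 0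
      else if bitAt (p + 3) w i = a then 1 else 0),
      prod_fin_ends p (fun i => if bitAt (p + 3) w i = a then (1 : ℂ) else 0), ← mul_assoc]
    congr 1
    · have h : (Real.sqrt 2 : ℂ) * Real.sqrt 2 = 2 := by
        norm_cast
        exact Real.mul_self_sqrt (by norm_num)
      simp only [true_or, or_true, if_true]
      split_ifs <;> simp [h]
    · refine Finset.prod_congr rfl fun k hk => ?_
      have hk := Finset.mem_range.1 hk
      rw [if_neg (by omega)]
  have hK : ((Real.sqrt 2 : ℂ))⁻¹ ^ (2 * p + 3) * 2 ^ p * 2 = ((Real.sqrt 2 : ℂ))⁻¹ := by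
    have h : (Real.sqrt 2 : ℂ)⁻¹ ^ 2 = 2⁻¹ := by
      rw [inv_pow, ← Complex.ofReal_pow, Real.sq_sqrt (by norm_num), Complex.ofReal_ofNat]
    rw [show 2 * p + 3 = 2 * (p + 1) + 1 by ring, pow_succ, pow_mul, h, mul_assoc, ← pow_succ,
      mul_right_comm, ← mul_pow]
    norm_num
  simp only [hprod, ← Finset.mul_sum]
  linear_combination ((∏ k ∈ Finset.range p, (starRingEnd ℂ) (χ (2 * k + 2) 0)) *
    ∑ a : Fin 2, ∏ i, if w i = a then (1 : ℂ) else 0) * hK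

lemma orderIsoOfFin_eq_survivor (p : ℕ) {V : Finset ℕ}
    (hV : V = Finset.range (2 * p + 3) \ (Finset.range p).image (fun k => 2 * k + 2))
    (hcard : V.card = p + 3) (i : Fin (p + 3)) :
    (V.orderIsoOfFin hcard i : ℕ) = survivor p i := by
  have h := Finset.orderEmbOfFin_unique hcard (f := fun i : Fin (p + 3) => survivor p i)
    (fun i => ?_) (fun i j hij => ?_)
  · rw [Finset.coe_orderIsoOfFin_apply, ← h]
  · subst hV
    simp only [Finset.mem_sdiff, Finset.mem_range, Finset.mem_image, survivor, not_exists]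
    constructor
    · omega
    · rintro k ⟨hk, hk'⟩
      omega
  · have := Fin.lt_def.1 hij
    simp only [survivor]
    omega

/-- **Saturation of the bound, odd case.** For odd `n ≥ 5`, measuring the qubits
`M = {k even, 2 ≤ k ≤ n−3}` of the `n`-qubit linear cluster state in the `σ_x` basis
leaves, for every outcome string, a state on the remaining `m = (n+3)/2` qubits that can
be transformed into the `m`-qubit GHZ state by local unitaries that are products of
Hadamard, `σ_x` and `σ_z` matrices. -/
theorem extract_ghz_odd (n : ℕ) (hn : 5 ≤ n) (hodd : Odd n)
    (m : ℕ) (hm : m = (n + 3) / 2)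
    (M : Finset ℕ) (hM : M = (Finset.range n).filter (fun k => Even k ∧ 2 ≤ k ∧ k ≤ n - 3))
    (V : Finset ℕ) (hVdef : V = Finset.range n \ M)
    (hcard : V.card = m)
    (b : ℕ → PauliBasis) (hb : ∀ j ∈ M, b j = PauliBasis.x)
    (s : ℕ → Fin 2)
    (χ : ℕ → Fin 2 → ℂ)
    (hχunit : ∀ j ∈ M, ∑ a : Fin 2, ‖χ j a‖ ^ 2 = 1)
    (hχeig : ∀ j ∈ M, (pauliOf (b j)).mulVec (χ j) = ((-1 : ℂ) ^ (s j : ℕ)) • χ j) :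
    ∃ U : Fin m → Matrix (Fin 2) (Fin 2) ℂ,
      (∀ i : Fin m, ∃ L : List (Matrix (Fin 2) (Fin 2) ℂ),
        (∀ A ∈ L, A ∈ ({hadamard, sigmaX, sigmaZ} : Set (Matrix (Fin 2) (Fin 2) ℂ))) ∧
        U i = L.prod) ∧
      ∃ c : ℂ, c ≠ 0 ∧ ‖c‖ = (Real.sqrt 2)⁻¹ ^ (n - m) ∧
        localApply m U (postMeas n m M (fun i => (V.orderIsoOfFin hcard i : ℕ)) χ)
          = c • ghzState m := by
  obtain ⟨q, rfl⟩ := hodd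
  obtain ⟨p, rfl⟩ : ∃ p, q = p + 1 := ⟨q - 1, by omega⟩
  obtain rfl : m = p + 3 := by omega
  have hM' : M = (Finset.range p).image (fun k => 2 * k + 2) := by
    ext j
    simp only [hM, Finset.mem_filter, Finset.mem_range, Finset.mem_image, Nat.even_iff]
    constructor
    · rintro ⟨h1, h2, h3, h4⟩
      exact ⟨j / 2 - 1, by omega, by omega⟩
    · rintro ⟨k, hk, rfl⟩
      omega
  clear hM
  subst hM'
  have hmem : ∀ k < p, 2 * k + 2 ∈ (Finset.range p).image (fun k => 2 * k + 2) := fun k hk =>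
    Finset.mem_image_of_mem _ (Finset.mem_range.2 hk)
  have hχ : ∀ k < p, χ (2 * k + 2) 1 = (-1) ^ (s (2 * k + 2) : ℕ) * χ (2 * k + 2) 0 :=
    fun k hk => eigenvector_sigmaX (by
      have h := hχeig _ (hmem k hk)
      rwa [hb _ (hmem k hk)] at h)
  have hnorm : ‖∏ k ∈ Finset.range p, (starRingEnd ℂ) (χ (2 * k + 2) 0)‖ =
      (Real.sqrt 2)⁻¹ ^ p := by
    rw [norm_prod, Finset.prod_congr rfl fun k hk => (RCLike.norm_conj _).trans
      (norm_eigenvector_sigmaX (hχ k (Finset.mem_range.1 hk))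
        (hχunit _ (hmem k (Finset.mem_range.1 hk))))]
    simp
  refine ⟨fun i => correction p s i, fun i => correction_eq_list_prod p s i,
    ∏ k ∈ Finset.range p, (starRingEnd ℂ) (χ (2 * k + 2) 0), ?_, ?_, ?_⟩
  · rw [← norm_pos_iff, hnorm]
    positivity
  · rw [hnorm]
    congr 1
    omega
  · simp only [orderIsoOfFin_eq_survivor p hVdef hcard]
    exact localApply_correction_postMeas p s χ hχ

end
end

section
/- Let n ≥ 4 be even, set m = (n+2)/2, let M = {k : k even, 2 ≤ k ≤ n−4} ∪ {n−1} ⊆ {0,…,n−1} and let V = {0,…,n−1} \ M, so |V| = m. Assign the basis b(j) = x for j ∈ M with j even, j ≤ n−4, and b(n−1) = z. Then for every outcome string s : M → Fin 2 and every choice of unit eigenvectors χ_j of σ_{b(j)} with eigenvalue (−1)^{s(j)}, there exist 2×2 complex matrices U_0, …, U_{m−1}, each a finite product of matrices from {H, σ_x, σ_z} where H is the Hadamard matrix (1/√2)·!![1,1;1,−1], and a scalar c ∈ ℂ with c ≠ 0, such that (⨂_i U_i) φ = c · GHZ_m, where φ is the post-measurement state determined by M, b, s and the χ_j. In particular m =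 ⌊(n+3)/2⌋, so the upper bound is saturated for even n as well. -/
noncomputable section

/-- The transfer vector of a linear chain of bits with site weights `f` and coupling
`(-1)^{ab}` between neighbours: `chainVec f k a` is the sum of the weights of all
configurations of the sites `0, …, k` whose last bit is `a`. -/
def chainVec (f : ℕ → Fin 2 → ℂ) : ℕ → Fin 2 → ℂ
  | 0 => f 0
  | k + 1 => fun a => f (k + 1) a * ∑ b : Fin 2, (-1 : ℂ) ^ ((b : ℕ) * (a : ℕ)) * chainVec f k b

lemma chainVec_succ (f : ℕ → Fin 2 → ℂ) (k : ℕ) (a : Fin 2) :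
    chainVec f (k + 1) a
      = f (k + 1) a * ∑ b : Fin 2, (-1 : ℂ) ^ ((b : ℕ) * (a : ℕ)) * chainVec f k b :=
  rfl

/-- The bit flips accumulated from the outcomes on the sites `2, 4, …, 2k`. -/
def flipParity (s : ℕ → Fin 2) (k : ℕ) : Fin 2 :=
  ∑ l ∈ Finset.range k, s (2 * l + 2)

/-- The local correction applied to the unmeasured site `j` of the chain of length
`2 * p + 4` with outcomes `s`. -/
def siteCorrection (p : ℕ) (s : ℕ → Fin 2) (j : ℕ) : Matrix (Fin 2) (Fin 2) ℂ :=
  if j = 0 then hadamard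
  else if j = 2 * p + 2 then
    sigmaX ^ ((flipParity s p + s (2 * p + 3) : Fin 2) : ℕ) * hadamard
  else sigmaX ^ (flipParity s (j / 2) : ℕ)

lemma bitAt_snoc_of_lt {k : ℕ} (v : Fin k → Fin 2) (a : Fin 2) {j : ℕ} (hj : j < k) :
    bitAt (k + 1) (Fin.snoc v a : Fin (k + 1) → Fin 2) j = bitAt k v j := by
  have h : j < k + 1 := by omega
  simp [bitAt, hj, h, Fin.snoc]

lemma bitAt_snoc_last {k : ℕ} (v : Fin k → Fin 2) (a : Fin 2) :
    bitAt (k + 1) (Fin.snoc v a : Fin (k + 1) → Fin 2) k = a := by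
  simp [bitAt, Fin.snoc]

lemma sum_snoc {k : ℕ} (F : (Fin (k + 1) → Fin 2) → ℂ) :
    ∑ v, F v = ∑ a : Fin 2, ∑ v : Fin k → Fin 2, F (Fin.snoc v a) := by
  rw [← (Fin.snocEquiv (fun _ : Fin (k + 1) => Fin 2)).sum_comp, Fintype.sum_prod_type]
  rfl

lemma sum_chain (f : ℕ → Fin 2 → ℂ) (k : ℕ) (F : Fin 2 → ℂ) :
    ∑ v : Fin (k + 1) → Fin 2, F (bitAt (k + 1) v k) *
      ((∏ j ∈ Finset.range (k + 1), f j (bitAt (k + 1) v j)) *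
        (-1 : ℂ) ^ (∑ i ∈ Finset.range k,
          (bitAt (k + 1) v i : ℕ) * (bitAt (k + 1) v (i + 1) : ℕ)))
      = ∑ a, F a * chainVec f k a := by
  induction k generalizing F with
  | zero =>
    rw [sum_snoc]
    simp [bitAt_snoc_last, chainVec]
  | succ k ih =>
    rw [sum_snoc]
    refine Finset.sum_congr rfl fun a _ => ?_
    rw [chainVec_succ, ← ih fun b => (-1 : ℂ) ^ ((b : ℕ) * (a : ℕ)), Finset.mul_sum,
      Finset.mul_sum]
    refine Finset.sum_congr rfl fun v _ => ?_
    rw [Finset.prod_range_succ, Finset.sum_range_succ, bitAt_snoc_last, pow_add,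
      bitAt_snoc_of_lt v a (Nat.lt_succ_self k)]
    have h1 : ∏ j ∈ Finset.range (k + 1),
        f j (bitAt (k + 1 + 1) (Fin.snoc v a : Fin (k + 1 + 1) → Fin 2) j)
        = ∏ j ∈ Finset.range (k + 1), f j (bitAt (k + 1) v j) :=
      Finset.prod_congr rfl fun j hj => by
        rw [bitAt_snoc_of_lt v a (Finset.mem_range.1 hj)]
    have h2 : ∑ i ∈ Finset.range k,
        (bitAt (k + 1 + 1) (Fin.snoc v a : Fin (k + 1 + 1) → Fin 2) i : ℕ) *
          (bitAt (k + 1 + 1) (Fin.snoc v a : Fin (k + 1 + 1) → Fin 2) (i + 1) : ℕ)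
        = ∑ i ∈ Finset.range k,
          (bitAt (k + 1) v i : ℕ) * (bitAt (k + 1) v (i + 1) : ℕ) :=
      Finset.sum_congr rfl fun i hi => by
        have := Finset.mem_range.1 hi
        rw [bitAt_snoc_of_lt v a (by omega), bitAt_snoc_of_lt v a (by omega)]
    rw [h1, h2]
    ring

lemma localApply_postMeas (n m : ℕ) (M : Finset ℕ) (ι : Fin m → ℕ) (χ : ℕ → Fin 2 → ℂ)
    (U : Fin m → Matrix (Fin 2) (Fin 2) ℂ) (w : Fin m → Fin 2) :
    localApply m U (postMeas n m M ι χ) w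
      = ∑ v : Fin n → Fin 2, (∏ i, U i (w i) (bitAt n v (ι i))) *
          ((∏ j ∈ M, (starRingEnd ℂ) (χ j (bitAt n v j))) * linCluster n v) := by
  simp only [localApply, postMeas, Finset.mul_sum, Finset.sum_filter]
  rw [Finset.sum_comm]
  refine Finset.sum_congr rfl fun v _ => ?_
  rw [Finset.sum_eq_single (fun i => bitAt n v (ι i))]
  · simp
  · intro w' _ hw'
    rw [if_neg fun h => hw' (funext h).symm]
    simp
  · simp

lemma sigmaX_eigenvector {χ : Fin 2 → ℂ} {s : Fin 2} (hu : ∑ a : Fin 2, ‖χ a‖ ^ 2 = 1)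
    (he : sigmaX.mulVec χ = ((-1 : ℂ) ^ (s : ℕ)) • χ) :
    ∃ γ : ℂ, γ ≠ 0 ∧ ∀ a, (starRingEnd ℂ) (χ a) = γ * (-1 : ℂ) ^ ((s : ℕ) * (a : ℕ)) := by
  have h := congrFun he 0
  simp [sigmaX, Matrix.mulVec, dotProduct, Fin.sum_univ_two] at h
  have h1 : (starRingEnd ℂ) (χ 1) = (starRingEnd ℂ) (χ 0) * (-1 : ℂ) ^ (s : ℕ) := by
    rw [h]; simp [mul_comm]
  refine ⟨(starRingEnd ℂ) (χ 0), fun h0 => ?_, fun a => ?_⟩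
  · have h0' : χ 0 = 0 := by simpa using h0
    simp [Fin.sum_univ_two, h, h0'] at hu
  · fin_cases a
    · simp
    · simpa using h1

lemma sigmaZ_eigenvector {χ : Fin 2 → ℂ} {s : Fin 2} (hu : ∑ a : Fin 2, ‖χ a‖ ^ 2 = 1)
    (he : sigmaZ.mulVec χ = ((-1 : ℂ) ^ (s : ℕ)) • χ) :
    ∃ γ : ℂ, γ ≠ 0 ∧ ∀ a, (starRingEnd ℂ) (χ a) = if a = s then γ else 0 := by
  have h0 := congrFun he 0
  have h1 := congrFun he 1
  simp [sigmaZ, Matrix.mulVec, dotProduct, Fin.sum_univ_two] at h0 h1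
  have key : ∀ a, a ≠ s → χ a = 0 := by
    intro a ha
    fin_cases s <;> fin_cases a <;> simp at ha h0 h1 ⊢
    · linear_combination (-1 / 2 : ℂ) * h1
    · linear_combination (1 / 2 : ℂ) * h0
  refine ⟨(starRingEnd ℂ) (χ s), fun hs => ?_, fun a => ?_⟩
  · have hs' : χ s = 0 := by simpa using hs
    have : ∀ a, χ a = 0 := fun a => by
      by_cases ha : a = s
      · rw [ha, hs']
      · exact key a ha
    simp [this] at hu
  · split_ifs with ha
    · rw [ha]
    · rw [key a ha, map_zero]

lemma sqrt_two_sq : (Real.sqrt 2 : ℂ) ^ 2 = 2 := by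
  rw [← Complex.ofReal_pow, Real.sq_sqrt (by norm_num)]
  norm_num

lemma sqrt_two_ne_zero : (Real.sqrt 2 : ℂ) ≠ 0 := by
  simp

lemma hadamard_apply (a b : Fin 2) :
    hadamard a b = ((Real.sqrt 2 : ℂ))⁻¹ * (-1 : ℂ) ^ ((a : ℕ) * (b : ℕ)) := by
  fin_cases a <;> fin_cases b <;> simp [hadamard]

lemma sigmaX_pow_apply (t a b : Fin 2) :
    (sigmaX ^ (t : ℕ)) a b = if b + t = a then 1 else 0 := by
  fin_cases t <;> fin_cases a <;> fin_cases b <;> simp [sigmaX]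

lemma sigmaX_pow_mul_hadamard_apply (t a b : Fin 2) :
    (sigmaX ^ (t : ℕ) * hadamard) a b
      = ((Real.sqrt 2 : ℂ))⁻¹ * (-1 : ℂ) ^ (((a + t : Fin 2) : ℕ) * (b : ℕ)) := by
  rw [Matrix.mul_apply]
  simp only [sigmaX_pow_apply, hadamard_apply]
  fin_cases t <;> fin_cases a <;> fin_cases b <;> simp

lemma sum_sign_mul_sum_sign (F : Fin 2 → ℂ) (a s : Fin 2) :
    ∑ b : Fin 2, (-1 : ℂ) ^ ((b : ℕ) * (a : ℕ)) * ((-1 : ℂ) ^ ((s : ℕ) * (b : ℕ)) *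
      ∑ c : Fin 2, (-1 : ℂ) ^ ((c : ℕ) * (b : ℕ)) * F c) = 2 * F (a + s) := by
  fin_cases a <;> fin_cases s <;> simp [Fin.sum_univ_two] <;> ring

lemma chainVec_odd (p : ℕ) (f : ℕ → Fin 2 → ℂ) (s : ℕ → Fin 2) (w : ℕ → Fin 2) (γ : ℕ → ℂ)
    (hzero : ∀ a, f 0 a = hadamard (w 0) a)
    (hodd : ∀ k ≤ p, ∀ a, f (2 * k + 1) a = (sigmaX ^ (flipParity s k : ℕ)) (w (2 * k + 1)) a)
    (heven : ∀ k < p, ∀ a,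
      f (2 * k + 2) a = γ k * (-1 : ℂ) ^ ((s (2 * k + 2) : ℕ) * (a : ℕ)))
    (k : ℕ) (hk : k ≤ p) (a : Fin 2) :
    chainVec f (2 * k + 1) a = (Real.sqrt 2 * ∏ l ∈ Finset.range k, (2 * γ l)) *
      if w 0 = a + flipParity s k ∧ ∀ l ≤ k, w (2 * l + 1) = a + flipParity s k
      then 1 else 0 := by
  induction k generalizing a with
  | zero =>
    have h := hodd 0 hk a
    have h2 := sqrt_two_sq
    have h3 := sqrt_two_ne_zero
    simp only [mul_zero, zero_add] at h
    simp only [mul_zero, zero_add, chainVec, h, hzero, hadamard_apply, sigmaX_pow_apply,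
      flipParity, Finset.range_zero, Finset.sum_empty, Finset.prod_empty, mul_one, add_zero,
      nonpos_iff_eq_zero, forall_eq]
    generalize w 0 = x
    generalize w 1 = y
    fin_cases x <;> fin_cases y <;> fin_cases a <;> simp <;> field_simp <;>
      (try linear_combination -h2)
  | succ k ih =>
    have hstep : chainVec f (2 * (k + 1) + 1) a
        = f (2 * (k + 1) + 1) a * (2 * γ k * chainVec f (2 * k + 1) (a + s (2 * k + 2))) := by
      rw [show 2 * (k + 1) + 1 = (2 * k + 1) + 1 + 1 by ring, chainVec_succ]
      simp only [chainVec_succ f (2 * k + 1), show 2 * k + 1 + 1 = 2 * k + 2 by ring, heven k (by omega)]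
      rw [mul_right_comm 2, ← sum_sign_mul_sum_sign, Finset.sum_mul]
      congr 1
      refine Finset.sum_congr rfl fun b _ => ?_
      ring
    have ht : a + s (2 * k + 2) + flipParity s k = a + flipParity s (k + 1) := by
      rw [flipParity, flipParity, Finset.sum_range_succ, add_assoc, add_comm (s _)]
    rw [hstep, ih (by omega), ht, hodd _ hk, sigmaX_pow_apply, Finset.prod_range_succ]
    have hiff : (w 0 = a + flipParity s (k + 1) ∧
        ∀ l ≤ k + 1, w (2 * l + 1) = a + flipParity s (k + 1)) ↔
        a + flipParity s (k + 1) = w (2 * (k + 1) + 1) ∧ w 0 = a + flipParity s (k + 1) ∧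
        ∀ l ≤ k, w (2 * l + 1) = a + flipParity s (k + 1) := by
      constructor
      · rintro ⟨h0, h⟩
        exact ⟨(h _ le_rfl).symm, h0, fun l hl => h l (by omega)⟩
      · rintro ⟨h1, h0, h⟩
        refine ⟨h0, fun l hl => ?_⟩
        rcases Nat.lt_or_ge k l with h' | h'
        · rw [show l = k + 1 by omega, h1]
        · exact h l h'
    rw [if_congr hiff rfl rfl, ite_and (P := _ = w (2 * (k + 1) + 1))]
    split_ifs <;> ring

lemma sum_chainVec_last (p : ℕ) (f : ℕ → Fin 2 → ℂ) (s : Fin 2) (t x : Fin 2) (κ : ℂ)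
    (hpen : ∀ a, f (2 * p + 2) a = (sigmaX ^ ((t + s : Fin 2) : ℕ) * hadamard) x a)
    (hlast : ∀ a, f (2 * p + 3) a = if a = s then κ else 0) :
    ∑ a, chainVec f (2 * p + 3) a = κ * Real.sqrt 2 * chainVec f (2 * p + 1) (x + t) := by
  have h2 := sqrt_two_sq
  have h3 := sqrt_two_ne_zero
  simp only [chainVec_succ f (2 * p + 2), chainVec_succ f (2 * p + 1), hlast, hpen,
    sigmaX_pow_mul_hadamard_apply, ite_mul, zero_mul,
    Finset.sum_ite_eq', Finset.mem_univ, if_true, mul_assoc κ]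
  congr 1
  have hsum := sum_sign_mul_sum_sign (chainVec f (2 * p + 1)) s (x + (t + s))
  have hxt : s + (x + (t + s)) = x + t := by
    clear hsum hpen hlast
    revert s x t
    decide
  rw [hxt] at hsum
  calc _ = ((Real.sqrt 2 : ℂ))⁻¹ * (2 * chainVec f (2 * p + 1) (x + t)) := by
        rw [← hsum, Finset.mul_sum]
        refine Finset.sum_congr rfl fun b _ => ?_
        ring
    _ = _ := by
        field_simp
        linear_combination -chainVec f (2 * p + 1) (x + t) * h2

lemma sum_chainVec_eq_ghz (p : ℕ) (f : ℕ → Fin 2 → ℂ) (s : ℕ → Fin 2) (w : ℕ → Fin 2)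
    (γ : ℕ → ℂ) (κ : ℂ)
    (hf : ∀ j, j = 0 ∨ j = 2 * p + 2 ∨ (j % 2 = 1 ∧ j < 2 * p + 2) →
      ∀ a, f j a = siteCorrection p s j (w j) a)
    (heven : ∀ k < p, ∀ a,
      f (2 * k + 2) a = γ k * (-1 : ℂ) ^ ((s (2 * k + 2) : ℕ) * (a : ℕ)))
    (hlast : ∀ a, f (2 * p + 3) a = if a = s (2 * p + 3) then κ else 0) :
    ∑ a, chainVec f (2 * p + 3) a
      = (κ * Real.sqrt 2) * (Real.sqrt 2 * ∏ l ∈ Finset.range p, (2 * γ l)) *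
        if w 0 = w (2 * p + 2) ∧ ∀ l ≤ p, w (2 * l + 1) = w (2 * p + 2) then 1 else 0 := by
  rw [sum_chainVec_last p f (s (2 * p + 3)) (flipParity s p) (w (2 * p + 2)) κ _ hlast,
    chainVec_odd p f s w γ _ _ heven p le_rfl]
  · have h : w (2 * p + 2) + flipParity s p + flipParity s p = w (2 * p + 2) := by
      generalize w (2 * p + 2) = x
      generalize flipParity s p = t
      revert x t
      decide
    rw [h]
    ring
  · intro a
    rw [hf 0 (by simp), siteCorrection, if_pos rfl]
  · intro k hk a
    rw [hf _ (by omega), siteCorrection, if_neg (by omega), if_neg (by omega),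
      show (2 * k + 1) / 2 = k by omega]
  · intro a
    rw [hf _ (by omega), siteCorrection, if_neg (by omega), if_pos rfl]

lemma siteCorrection_eq_prod (p : ℕ) (s : ℕ → Fin 2) (j : ℕ) :
    ∃ L : List (Matrix (Fin 2) (Fin 2) ℂ),
      (∀ A ∈ L, A ∈ ({hadamard, sigmaX, sigmaZ} : Set (Matrix (Fin 2) (Fin 2) ℂ))) ∧
      siteCorrection p s j = L.prod := by
  unfold siteCorrection
  split_ifs
  · exact ⟨[hadamard], by simp, by simp⟩
  · refine ⟨List.replicate _ sigmaX ++ [hadamard], ?_, by simp; rfl⟩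
    intro A hA
    rcases List.mem_append.1 hA with h | h
    · simp [List.eq_of_mem_replicate h]
    · simp [List.mem_singleton.1 h]
  · refine ⟨List.replicate _ sigmaX, fun A hA => ?_, by simp; rfl⟩
    simp [List.eq_of_mem_replicate hA]

/-- **Saturation of the bound, even case.** For even `n ≥ 4`, measuring the qubits
`{k even, 2 ≤ k ≤ n−4}` in the `σ_x` basis and qubit `n−1` in the `σ_z` basis leaves,
for every outcome string, a state on the remaining `m = (n+2)/2` qubits that can be
transformed into the `m`-qubit GHZ state by local unitaries that are products of
Hadamard, `σ_x` and `σ_z` matrices; in particular `m = ⌊(n+3)/2⌋`. -/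
theorem extract_ghz_even (n : ℕ) (hn : 4 ≤ n) (heven : Even n)
    (m : ℕ) (hm : m = (n + 2) / 2)
    (M : Finset ℕ)
    (hM : M = (Finset.range n).filter (fun k => Even k ∧ 2 ≤ k ∧ k ≤ n - 4) ∪ {n - 1})
    (V : Finset ℕ) (hVdef : V = Finset.range n \ M)
    (hcard : V.card = m)
    (b : ℕ → PauliBasis)
    (hbx : ∀ j ∈ M, Even j → j ≤ n - 4 → b j = PauliBasis.x)
    (hbz : b (n - 1) = PauliBasis.z)
    (s : ℕ → Fin 2)
    (χ : ℕ → Fin 2 → ℂ)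
    (hχunit : ∀ j ∈ M, ∑ a : Fin 2, ‖χ j a‖ ^ 2 = 1)
    (hχeig : ∀ j ∈ M, (pauliOf (b j)).mulVec (χ j) = ((-1 : ℂ) ^ (s j : ℕ)) • χ j) :
    m = (n + 3) / 2 ∧
    ∃ U : Fin m → Matrix (Fin 2) (Fin 2) ℂ,
      (∀ i : Fin m, ∃ L : List (Matrix (Fin 2) (Fin 2) ℂ),
        (∀ A ∈ L, A ∈ ({hadamard, sigmaX, sigmaZ} : Set (Matrix (Fin 2) (Fin 2) ℂ))) ∧
        U i = L.prod) ∧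
      ∃ c : ℂ, c ≠ 0 ∧
        localApply m U (postMeas n m M (fun i => (V.orderIsoOfFin hcard i : ℕ)) χ)
          = c • ghzState m := by
  obtain ⟨p, rfl⟩ : ∃ p, n = 2 * p + 4 := by
    obtain ⟨q, rfl⟩ := heven
    exact ⟨q - 2, by omega⟩
  refine ⟨by omega, ?_⟩
  have hMmem : ∀ j, j ∈ M ↔ (j % 2 = 0 ∧ 2 ≤ j ∧ j ≤ 2 * p) ∨ j = 2 * p + 3 := by
    intro j
    rw [hM]
    simp only [Finset.mem_union, Finset.mem_filter, Finset.mem_range, Finset.mem_singleton,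
      Nat.even_iff]
    omega
  have hVmem : ∀ j, j ∈ V ↔ j = 0 ∨ j = 2 * p + 2 ∨ (j % 2 = 1 ∧ j < 2 * p + 2) := by
    intro j
    rw [hVdef, Finset.mem_sdiff, hMmem, Finset.mem_range]
    omega
  have hMn : M ⊆ Finset.range (2 * p + 4) := fun j hj => by
    rw [hMmem] at hj
    rw [Finset.mem_range]
    omega
  have hx : ∀ k, ∃ γ : ℂ, γ ≠ 0 ∧ (k < p → ∀ a, (starRingEnd ℂ) (χ (2 * k + 2) a)
      = γ * (-1 : ℂ) ^ ((s (2 * k + 2) : ℕ) * (a : ℕ))) := by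
    intro k
    by_cases hk : k < p
    · have hkM : 2 * k + 2 ∈ M := (hMmem _).2 (by omega)
      have he := hχeig _ hkM
      rw [hbx _ hkM (by simp [Nat.even_iff]) (by omega)] at he
      obtain ⟨γ, h0, h⟩ := sigmaX_eigenvector (hχunit _ hkM) he
      exact ⟨γ, h0, fun _ => h⟩
    · exact ⟨1, one_ne_zero, fun h => absurd h hk⟩
  choose γ hγ0 hγ using hx
  have hzM : 2 * p + 3 ∈ M := (hMmem _).2 (Or.inr rfl)
  obtain ⟨κ, hκ0, hκ⟩ : ∃ κ : ℂ, κ ≠ 0 ∧ ∀ a, (starRingEnd ℂ) (χ (2 * p + 3) a)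
      = if a = s (2 * p + 3) then κ else 0 := by
    have he := hχeig _ hzM
    rw [show b (2 * p + 3) = PauliBasis.z from hbz] at he
    exact sigmaZ_eigenvector (hχunit _ hzM) he
  set e := V.orderIsoOfFin hcard
  refine ⟨fun i => siteCorrection p s (e i), fun i => siteCorrection_eq_prod p s _,
    ((Real.sqrt 2 : ℂ))⁻¹ ^ (2 * p + 4) * ((κ * Real.sqrt 2) *
      (Real.sqrt 2 * ∏ l ∈ Finset.range p, (2 * γ l))) * Real.sqrt 2, ?_, ?_⟩
  · have h3 := sqrt_two_ne_zero
    have hprod : ∏ l ∈ Finset.range p, (2 * γ l) ≠ 0 :=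
      Finset.prod_ne_zero_iff.2 fun l _ => mul_ne_zero two_ne_zero (hγ0 l)
    positivity
  · funext w
    let w' : ℕ → Fin 2 := fun j => if h : j ∈ V then w (e.symm ⟨j, h⟩) else 0
    have hw' : ∀ i, w' (e i) = w i := fun i => by simp [w']
    let f : ℕ → Fin 2 → ℂ := fun j a =>
      if j ∈ V then siteCorrection p s j (w' j) a else (starRingEnd ℂ) (χ j a)
    have hfV : ∀ j ∈ V, ∀ a, f j a = siteCorrection p s j (w' j) a :=
      fun j hj a => if_pos hj
    have hfM : ∀ j ∈ M, ∀ a, f j a = (starRingEnd ℂ) (χ j a) := fun j hj a =>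
      if_neg fun h => by simp [hVdef, hj] at h
    have hprod : ∀ v : Fin (2 * p + 4) → Fin 2,
        (∏ i, siteCorrection p s (e i) (w i) (bitAt (2 * p + 4) v (e i))) *
          (∏ j ∈ M, (starRingEnd ℂ) (χ j (bitAt (2 * p + 4) v j)))
        = ∏ j ∈ Finset.range (2 * p + 4), f j (bitAt (2 * p + 4) v j) := by
      intro v
      rw [← Finset.prod_sdiff hMn, ← hVdef]
      congr 1
      · rw [← Finset.prod_coe_sort V, ← e.toEquiv.prod_comp]
        refine Finset.prod_congr rfl fun i _ => ?_
        change _ = f (e i) (bitAt (2 * p + 4) v (e i))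
        rw [hfV _ (e i).2, hw']
      · exact Finset.prod_congr rfl fun j hj => (hfM j hj _).symm
    have hghz : (∀ i j, w i = w j) ↔
        w' 0 = w' (2 * p + 2) ∧ ∀ l ≤ p, w' (2 * l + 1) = w' (2 * p + 2) := by
      have hw'V : (∀ i j, w i = w j) ↔ ∀ i ∈ V, w' i = w' (2 * p + 2) := by
        have hmem : 2 * p + 2 ∈ V := (hVmem _).2 (by omega)
        constructor
        · intro h i hi
          simp only [w', dif_pos hi, dif_pos hmem]
          exact h _ _
        · intro h i j
          rw [← hw' i, ← hw' j, h _ (e i).2, h _ (e j).2]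
      rw [hw'V]
      constructor
      · exact fun h => ⟨h _ ((hVmem _).2 (by omega)), fun l hl => h _ ((hVmem _).2 (by omega))⟩
      · rintro ⟨h0, h⟩ i hi
        rcases (hVmem i).1 hi with rfl | rfl | hi'
        · exact h0
        · rfl
        · rw [show i = 2 * (i / 2) + 1 by omega]
          exact h _ (by omega)
    have hsum := sum_chain f (2 * p + 3) fun _ => 1
    simp only [one_mul] at hsum
    rw [sum_chainVec_eq_ghz p f s w' γ κ (fun j hj => hfV j ((hVmem j).2 hj))
      (fun k hk a => by rw [hfM _ ((hMmem _).2 (by omega)), hγ k hk])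
      (fun a => by rw [hfM _ hzM, hκ]), ← if_congr hghz rfl rfl] at hsum
    rw [localApply_postMeas, Pi.smul_apply, smul_eq_mul, ghzState]
    calc _ = ((Real.sqrt 2 : ℂ))⁻¹ ^ (2 * p + 4) *
          ∑ v : Fin (2 * p + 3 + 1) → Fin 2,
            (∏ j ∈ Finset.range (2 * p + 3 + 1), f j (bitAt (2 * p + 3 + 1) v j)) *
              (-1 : ℂ) ^ (∑ i ∈ Finset.range (2 * p + 3),
                (bitAt (2 * p + 3 + 1) v i : ℕ) * (bitAt (2 * p + 3 + 1) v (i + 1) : ℕ)) := by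
          rw [Finset.mul_sum]
          refine Finset.sum_congr rfl fun v _ => ?_
          rw [← mul_assoc, hprod, linCluster]
          exact mul_left_comm _ _ _
      _ = _ := by
          rw [hsum]
          have h3 := sqrt_two_ne_zero
          split_ifs
          · field_simp
          · simp

end
end

section
/- (Theorem 1, quantum form.) Let n ∈ ℕ and let V ⊆ {0,…,n−1} with |V| = m such that 2m > n + 3 (i.e., m exceeds ⌊(n+3)/2⌋). Let M = {0,…,n−1} \ V. Then for every basis assignment b : M → {x,y,z}, every outcome string s : M → Fin 2, every choice of unit eigenvectors χ_j of σ_{b(j)} with eigenvalue (−1)^{s(j)}, every family of 2×2 Clifford unitaries U_0, …, U_{m−1}, and every scalar c ∈ ℂ with c ≠ 0, one has (⨂_i U_i) φ ≠ c · GHZ_m, where φ is the post-measurement state determined by M, b, s and the χ_j. -/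
noncomputable section

/-- The unnormalised overlap of the linear cluster state with the product functional `⨂ θ_j`. -/
def clusterContract (n : ℕ) (θ : ℕ → Fin 2 → ℂ) : ℂ :=
  ∑ v : Fin n → Fin 2, (∏ j ∈ Finset.range n, θ j (bitAt n v j)) * linCluster n v

theorem bitAt_append_left {a b : ℕ} (u : Fin a → Fin 2) (w : Fin b → Fin 2) {j : ℕ}
    (hj : j < a) : bitAt (a + b) (Fin.append u w) j = bitAt a u j := by
  have h : (⟨j, by omega⟩ : Fin (a + b)) = Fin.castAdd b ⟨j, hj⟩ := rfl
  simp only [bitAt, hj, show j < a + b by omega, dite_true]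
  rw [h, Fin.append_left]

theorem bitAt_append_right {a b : ℕ} (u : Fin a → Fin 2) (w : Fin b → Fin 2) (j : ℕ) :
    bitAt (a + b) (Fin.append u w) (a + j) = bitAt b w j := by
  by_cases hj : j < b
  · have h : (⟨a + j, by omega⟩ : Fin (a + b)) = Fin.natAdd a ⟨j, hj⟩ := rfl
    simp only [bitAt, hj, show a + j < a + b by omega, dite_true]
    rw [h, Fin.append_right]
  · simp [bitAt, hj]

theorem linCluster_append {a b : ℕ} (u : Fin (a + 1) → Fin 2) (w : Fin (b + 1) → Fin 2) :
    linCluster (a + 1 + (b + 1)) (Fin.append u w) =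
      linCluster (a + 1) u * linCluster (b + 1) w *
        (-1 : ℂ) ^ ((bitAt (a + 1) u a : ℕ) * (bitAt (b + 1) w 0 : ℕ)) := by
  have hexp : ∑ i ∈ Finset.range (a + 1 + (b + 1) - 1),
      (bitAt (a + 1 + (b + 1)) (Fin.append u w) i : ℕ) *
        (bitAt (a + 1 + (b + 1)) (Fin.append u w) (i + 1) : ℕ) =
      (∑ i ∈ Finset.range a, (bitAt (a + 1) u i : ℕ) * (bitAt (a + 1) u (i + 1) : ℕ)) +
        (bitAt (a + 1) u a : ℕ) * (bitAt (b + 1) w 0 : ℕ) +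
        ∑ i ∈ Finset.range b, (bitAt (b + 1) w i : ℕ) * (bitAt (b + 1) w (i + 1) : ℕ) := by
    rw [show a + 1 + (b + 1) - 1 = a + 1 + b by omega, Finset.sum_range_add,
      Finset.sum_range_succ]
    congr 1
    · congr 1
      · refine Finset.sum_congr rfl fun i hi => ?_
        rw [Finset.mem_range] at hi
        rw [bitAt_append_left u w (by omega), bitAt_append_left u w (by omega)]
      · rw [bitAt_append_left u w (by omega)]
        congr 2
        exact bitAt_append_right u w 0
    · refine Finset.sum_congr rfl fun i _ => ?_
      rw [bitAt_append_right, add_assoc (a + 1) i 1, bitAt_append_right]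
  unfold linCluster
  rw [hexp]
  simp only [Nat.add_sub_cancel, pow_add]
  ring

/-- Fixing the two bits at a link of the chain factorises the contraction. -/
theorem clusterContract_split (a b : ℕ) (θ : ℕ → Fin 2 → ℂ) (x y : Fin 2)
    (hx : θ a = Pi.single x 1) (hy : θ (a + 1) = Pi.single y 1) :
    clusterContract (a + 1 + (b + 1)) θ =
      (-1 : ℂ) ^ ((x : ℕ) * (y : ℕ)) * clusterContract (a + 1) θ *
        clusterContract (b + 1) (fun j => θ (a + 1 + j)) := by
  unfold clusterContract
  rw [← (Fin.appendEquiv (a + 1) (b + 1)).sum_comp, Fintype.sum_prod_type, mul_assoc,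
    Finset.sum_mul_sum, Finset.mul_sum]
  refine Finset.sum_congr rfl fun u _ => ?_
  rw [Finset.mul_sum]
  refine Finset.sum_congr rfl fun w _ => ?_
  change (∏ j ∈ _, θ j (bitAt _ (Fin.append u w) j)) * linCluster _ (Fin.append u w) = _
  rw [Finset.prod_range_add, linCluster_append,
    Finset.prod_congr rfl fun j hj => by
      rw [bitAt_append_left u w (Finset.mem_range.mp hj)]]
  simp only [bitAt_append_right]
  by_cases hu : bitAt (a + 1) u a = x
  · by_cases hw : bitAt (b + 1) w 0 = y
    · rw [hu, hw]
      ring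
    · have h0 : ∏ j ∈ Finset.range (b + 1), θ (a + 1 + j) (bitAt (b + 1) w j) = 0 :=
        Finset.prod_eq_zero (i := 0) (by simp) (by
          rw [add_zero, hy, Pi.single_eq_of_ne hw])
      rw [h0]
      ring
  · have h0 : ∏ j ∈ Finset.range (a + 1), θ j (bitAt (a + 1) u j) = 0 :=
      Finset.prod_eq_zero (i := a) (by simp) (by rw [hx, Pi.single_eq_of_ne hu])
    rw [h0]
    ring

theorem clusterContract_congr {n : ℕ} {θ θ' : ℕ → Fin 2 → ℂ} (h : ∀ j < n, θ j = θ' j) :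
    clusterContract n θ = clusterContract n θ' := by
  unfold clusterContract
  refine Finset.sum_congr rfl fun v _ => ?_
  congr 1
  exact Finset.prod_congr rfl fun j hj => by rw [h j (Finset.mem_range.mp hj)]

/-- Two nonvanishing contractions that fix the bits `p` and `p + 1` may be recombined across
the link between `p` and `p + 1`. -/
theorem clusterContract_mix_ne_zero {n p : ℕ} (hp : p + 1 < n) {θ θ' θ'' : ℕ → Fin 2 → ℂ}
    {x y x' y' : Fin 2}
    (hx : θ p = Pi.single x 1) (hy : θ (p + 1) = Pi.single y 1)
    (hx' : θ' p = Pi.single x' 1) (hy' : θ' (p + 1) = Pi.single y' 1)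
    (hleft : ∀ j ≤ p, θ'' j = θ j) (hright : ∀ j, p < j → θ'' j = θ' j)
    (h : clusterContract n θ ≠ 0) (h' : clusterContract n θ' ≠ 0) :
    clusterContract n θ'' ≠ 0 := by
  obtain ⟨b, rfl⟩ : ∃ b, n = p + 1 + (b + 1) := ⟨n - p - 2, by omega⟩
  rw [clusterContract_split p b θ x y hx hy] at h
  rw [clusterContract_split p b θ' x' y' hx' hy'] at h'
  rw [clusterContract_split p b θ'' x y' (by rw [hleft p le_rfl, hx])
    (by rw [hright (p + 1) (by omega), hy']),
    clusterContract_congr (fun j hj => hleft j (by omega)),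
    clusterContract_congr (fun j _ => hright (p + 1 + j) (by omega))]
  exact mul_ne_zero (mul_ne_zero (by simp) (right_ne_zero_of_mul (left_ne_zero_of_mul h)))
    (right_ne_zero_of_mul h')

theorem sum_prod_mul_localApply (m : ℕ) (U : Fin m → Matrix (Fin 2) (Fin 2) ℂ)
    (ψ : (Fin m → Fin 2) → ℂ) (ζ : Fin m → Fin 2 → ℂ) :
    ∑ w, (∏ i, ζ i (w i)) * localApply m U ψ w =
      ∑ w, (∏ i, Matrix.vecMul (ζ i) (U i) (w i)) * ψ w := by
  unfold localApply
  simp only [Finset.mul_sum]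
  rw [Finset.sum_comm]
  refine Finset.sum_congr rfl fun w _ => ?_
  simp only [Matrix.vecMul, dotProduct, Finset.prod_univ_sum, Fintype.piFinset_univ,
    Finset.prod_mul_distrib, Finset.sum_mul, mul_assoc]

theorem sum_prod_mul_ghzState {m : ℕ} (hm : 0 < m) (ζ : Fin m → Fin 2 → ℂ) :
    ∑ w, (∏ i, ζ i (w i)) * ghzState m w =
      ((Real.sqrt 2 : ℂ))⁻¹ * (∏ i, ζ i 0 + ∏ i, ζ i 1) := by
  have hne : (fun _ : Fin m => (0 : Fin 2)) ≠ fun _ => 1 := fun h => by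
    simpa using congrFun h ⟨0, hm⟩
  rw [← Finset.sum_subset (Finset.subset_univ {fun _ => 0, fun _ => 1}), Finset.sum_pair hne]
  · simp only [ghzState, implies_true, if_true]
    ring
  · intro w _ hw
    rw [ghzState, if_neg, mul_zero]
    intro hconst
    have hw' : w = fun _ => w ⟨0, hm⟩ := funext fun i => hconst i _
    apply hw
    rw [hw', Finset.mem_insert, Finset.mem_singleton]
    rcases Fin.exists_fin_two.mp ⟨w ⟨0, hm⟩, rfl⟩ with h | h
    · left; rw [← h]
    · right; rw [← h]

theorem prod_orderIsoOfFin {m : ℕ} {V : Finset ℕ} (hcard : V.card = m) (f : ℕ → ℂ) :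
    ∏ i : Fin m, f (V.orderIsoOfFin hcard i) = ∏ j ∈ V, f j := by
  rw [← Finset.prod_coe_sort V]
  exact (V.orderIsoOfFin hcard).toEquiv.prod_comp fun j : V => f j

theorem sum_prod_mul_postMeas {n m : ℕ} {V : Finset ℕ} (hVsub : V ⊆ Finset.range n)
    (hcard : V.card = m) (χ θ : ℕ → Fin 2 → ℂ)
    (hθ : ∀ j ∈ Finset.range n \ V, θ j = fun a => starRingEnd ℂ (χ j a)) :
    ∑ w, (∏ i, θ (V.orderIsoOfFin hcard i) (w i)) *
        postMeas n m (Finset.range n \ V) (fun i => (V.orderIsoOfFin hcard i : ℕ)) χ w =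
      clusterContract n θ := by
  unfold postMeas clusterContract
  have hfilter : ∀ w : Fin m → Fin 2,
      (Finset.univ.filter fun v : Fin n → Fin 2 =>
        ∀ i : Fin m, bitAt n v (V.orderIsoOfFin hcard i) = w i) =
      Finset.univ.filter fun v : Fin n → Fin 2 =>
        (fun i : Fin m => bitAt n v (V.orderIsoOfFin hcard i)) = w := fun w => by
    simp only [funext_iff]
  rw [← Finset.sum_fiberwise Finset.univ
    (fun (v : Fin n → Fin 2) (i : Fin m) => bitAt n v (V.orderIsoOfFin hcard i))]
  refine Finset.sum_congr rfl fun w _ => ?_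
  rw [hfilter, Finset.mul_sum]
  refine Finset.sum_congr rfl fun v hv => ?_
  obtain rfl := (Finset.mem_filter.mp hv).2
  rw [prod_orderIsoOfFin hcard fun j => θ j (bitAt n v j), ← mul_assoc,
    ← Finset.prod_sdiff hVsub, mul_comm (∏ j ∈ V, _)]
  congr 2
  exact Finset.prod_congr rfl fun j hj => by rw [hθ j hj]

/-- A set filling more than `(n + 3) / 2` of the sites `0, …, n - 1` contains two neighbouring
sites with further elements of the set on both sides. -/
theorem exists_interior_neighbors {n : ℕ} {V : Finset ℕ} (hVsub : V ⊆ Finset.range n)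
    (hbig : n + 3 < 2 * V.card) :
    ∃ p, p ∈ V ∧ p + 1 ∈ V ∧ (∃ i ∈ V, i < p) ∧ ∃ k ∈ V, p + 1 < k := by
  by_contra! hcon
  have hne : V.Nonempty := Finset.card_pos.mp (by omega)
  set lo := V.min' hne
  set hi := V.max' hne
  have hmaps : ∀ p ∈ V \ {lo, hi, hi - 1}, p + 1 ∈ Finset.range n \ V := by
    intro p hp
    simp only [Finset.mem_sdiff, Finset.mem_insert, Finset.mem_singleton, not_or] at hp
    obtain ⟨hpV, hlo, hhi, hpred⟩ := hp
    have h1 : lo ≤ p := V.min'_le p hpV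
    have h2 : p ≤ hi := V.le_max' p hpV
    have h3 : hi < n := Finset.mem_range.mp (hVsub (V.max'_mem hne))
    refine Finset.mem_sdiff.mpr ⟨Finset.mem_range.mpr (by omega), fun hmem => ?_⟩
    have := hcon p hpV hmem ⟨lo, V.min'_mem hne, by omega⟩ hi (V.max'_mem hne)
    omega
  have hle := Finset.card_le_card_of_injOn (· + 1) hmaps fun _ _ _ _ h => by simpa using h
  have h1 := Finset.le_card_sdiff {lo, hi, hi - 1} V
  have h2 : ({lo, hi, hi - 1} : Finset ℕ).card ≤ 3 := Finset.card_le_three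
  have hVn := Finset.card_le_card hVsub
  rw [Finset.card_sdiff_of_subset hVsub] at hle
  rw [Finset.card_range] at hle hVn
  omega

theorem exists_inv_apply_ne_zero {A : Matrix (Fin 2) (Fin 2) ℂ} (hA : IsUnit A.det)
    (k : Fin 2) : ∃ x, A⁻¹ x k ≠ 0 := by
  by_contra! h
  have h1 := congrFun (congrFun (A.mul_nonsing_inv hA) k) k
  simp [Matrix.mul_apply, h] at h1

/-- The product functional that is `⟨s|` on the sites before `p`, `u` on `p`, `w` on `p + 1`
and `⟨t|` on the later sites. -/
def linkFunctional (p : ℕ) (s t : Fin 2) (u w : Fin 2 → ℂ) (j : ℕ) : Fin 2 → ℂ :=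
  if j < p then Pi.single s 1 else if j = p then u else if j = p + 1 then w else Pi.single t 1

theorem linkFunctional_at (p : ℕ) (s t : Fin 2) (u w : Fin 2 → ℂ) :
    linkFunctional p s t u w p = u := by simp [linkFunctional]

theorem linkFunctional_succ (p : ℕ) (s t : Fin 2) (u w : Fin 2 → ℂ) :
    linkFunctional p s t u w (p + 1) = w := by simp [linkFunctional]

theorem linkFunctional_left {p j : ℕ} (s t : Fin 2) (u w : Fin 2 → ℂ) (hj : j < p) :
    linkFunctional p s t u w j = Pi.single s 1 := if_pos hj

theorem linkFunctional_right {p j : ℕ} (s t : Fin 2) (u w : Fin 2 → ℂ) (hj : p + 1 < j) :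
    linkFunctional p s t u w j = Pi.single t 1 := by
  rw [linkFunctional, if_neg (by omega), if_neg (by omega), if_neg (by omega)]

theorem linkFunctional_apply_ne_zero (p j : ℕ) (s : Fin 2) {u w : Fin 2 → ℂ}
    (hu : u s ≠ 0) (hw : w s ≠ 0) : linkFunctional p s s u w j s ≠ 0 := by
  unfold linkFunctional
  split_ifs <;> simp [hu, hw]

/-- **Theorem 1 (quantum form).** If `V ⊆ {0,…,n−1}` has more than `⌊(n+3)/2⌋` elements
(i.e. `2|V| > n+3`), then no Pauli measurement pattern on the complementary qubits `M`,
followed by local Clifford unitaries, can turn the `n`-qubit linear cluster state into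
the `|V|`-qubit GHZ state. -/
theorem no_ghz_above_bound (n m : ℕ) (V : Finset ℕ)
    (hVsub : V ⊆ Finset.range n) (hcard : V.card = m) (hbig : n + 3 < 2 * m)
    (M : Finset ℕ) (hM : M = Finset.range n \ V)
    (b : ℕ → PauliBasis)
    (s : ℕ → Fin 2)
    (χ : ℕ → Fin 2 → ℂ)
    (hχunit : ∀ j ∈ M, ∑ a : Fin 2, ‖χ j a‖ ^ 2 = 1)
    (hχeig : ∀ j ∈ M, (pauliOf (b j)).mulVec (χ j) = ((-1 : ℂ) ^ (s j : ℕ)) • χ j)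
    (U : Fin m → Matrix (Fin 2) (Fin 2) ℂ) (hU : ∀ i : Fin m, IsClifford (U i))
    (c : ℂ) (hc : c ≠ 0) :
    localApply m U (postMeas n m M (fun i => (V.orderIsoOfFin hcard i : ℕ)) χ)
      ≠ c • ghzState m := by
  subst hM
  intro heq
  have hm : 0 < m := by omega
  obtain ⟨p, hp, hp', ⟨i, hi, hip⟩, k, hk, hpk⟩ :=
    exists_interior_neighbors hVsub (by omega : n + 3 < 2 * V.card)
  obtain ⟨W, hW⟩ : ∃ W : ℕ → Matrix (Fin 2) (Fin 2) ℂ,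
      ∀ i, W (V.orderIsoOfFin hcard i) = U i :=
    ⟨Function.extend (fun i => (V.orderIsoOfFin hcard i : ℕ)) U 0, fun i =>
      (Subtype.val_injective.comp (V.orderIsoOfFin hcard).injective).extend_apply U 0 i⟩
  have hWdet : ∀ j ∈ V, IsUnit (W j).det := by
    intro j hj
    obtain ⟨i, hi⟩ := (V.orderIsoOfFin hcard).surjective ⟨j, hj⟩
    have := hW i
    rw [hi] at this
    rw [this]
    exact Matrix.UnitaryGroup.det_isUnit ⟨U i, (hU i).1⟩
  let Θ : (ℕ → Fin 2 → ℂ) → ℕ → Fin 2 → ℂ := fun Z j =>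
    if j ∈ V then Matrix.vecMul (Z j) (W j) else fun a => starRingEnd ℂ (χ j a)
  have hΘ : ∀ Z, clusterContract n (Θ Z) =
      c * ((Real.sqrt 2 : ℂ))⁻¹ * (∏ j ∈ V, Z j 0 + ∏ j ∈ V, Z j 1) := by
    intro Z
    rw [← sum_prod_mul_postMeas hVsub hcard χ (Θ Z)
      fun j hj => if_neg (Finset.mem_sdiff.mp hj).2]
    have h1 : ∀ i, Θ Z (V.orderIsoOfFin hcard i) =
        Matrix.vecMul (Z (V.orderIsoOfFin hcard i)) (U i) := fun i => by
      rw [← hW i]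
      exact if_pos (V.orderIsoOfFin hcard i).2
    simp only [h1]
    rw [← sum_prod_mul_localApply m U _ fun i => Z (V.orderIsoOfFin hcard i), heq,
      ← prod_orderIsoOfFin hcard fun j => Z j 0, ← prod_orderIsoOfFin hcard fun j => Z j 1,
      mul_assoc, ← sum_prod_mul_ghzState hm, Finset.mul_sum]
    refine Finset.sum_congr rfl fun w _ => ?_
    simp only [Pi.smul_apply, smul_eq_mul]
    ring
  let Z : Fin 2 → Fin 2 → Fin 2 → Fin 2 → ℕ → Fin 2 → ℂ := fun s t x y =>
    linkFunctional p s t ((W p)⁻¹ x) ((W (p + 1))⁻¹ y)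
  have hsingle : ∀ j ∈ V, ∀ x, Matrix.vecMul ((W j)⁻¹ x) (W j) = Pi.single x 1 := by
    intro j hj x
    ext a
    have h1 := congrFun (congrFun ((W j).nonsing_inv_mul (hWdet j hj)) x) a
    rw [Matrix.mul_apply] at h1
    rw [Matrix.vecMul, dotProduct, h1, Matrix.one_apply, Pi.single_apply]
    simp only [eq_comm]
  have hZp : ∀ s t x y, Θ (Z s t x y) p = Pi.single x 1 := fun s t x y => by
    simp only [Θ, Z, if_pos hp, linkFunctional_at, hsingle p hp]
  have hZp' : ∀ s t x y, Θ (Z s t x y) (p + 1) = Pi.single y 1 := fun s t x y => by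
    simp only [Θ, Z, if_pos hp', linkFunctional_succ, hsingle (p + 1) hp']
  have hzero : ∀ s t x y (a : Fin 2), a ≠ s ∨ a ≠ t → ∏ j ∈ V, Z s t x y j a = 0 := by
    rintro s t x y a (ha | ha)
    · exact Finset.prod_eq_zero hi (by
        simp only [Z, linkFunctional_left _ _ _ _ hip, Pi.single_eq_of_ne ha])
    · exact Finset.prod_eq_zero hk (by
        simp only [Z, linkFunctional_right _ _ _ _ hpk, Pi.single_eq_of_ne ha])
  have hsqrt : ((Real.sqrt 2 : ℂ))⁻¹ ≠ 0 := by simp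
  have hdiag : ∀ s, ∃ x y, clusterContract n (Θ (Z s s x y)) ≠ 0 := by
    intro s
    obtain ⟨x, hx⟩ := exists_inv_apply_ne_zero (hWdet p hp) s
    obtain ⟨y, hy⟩ := exists_inv_apply_ne_zero (hWdet (p + 1) hp') s
    have hne : ∏ j ∈ V, Z s s x y j s ≠ 0 :=
      Finset.prod_ne_zero_iff.mpr fun j _ => linkFunctional_apply_ne_zero p j s hx hy
    refine ⟨x, y, ?_⟩
    rw [hΘ]
    refine mul_ne_zero (mul_ne_zero hc hsqrt) ?_
    fin_cases s
    · rwa [hzero _ _ x y 1 (by simp), add_zero]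
    · rwa [hzero _ _ x y 0 (by simp), zero_add]
  obtain ⟨x, y, hxy⟩ := hdiag 0
  obtain ⟨x', y', hxy'⟩ := hdiag 1
  have hpn : p + 1 < n := Finset.mem_range.mp (hVsub hp')
  refine clusterContract_mix_ne_zero (θ'' := Θ (Z 0 1 x y')) hpn
    (hZp _ _ _ _) (hZp' _ _ _ _) (hZp _ _ _ _) (hZp' _ _ _ _) ?_ ?_ hxy hxy' ?_
  · intro j hj
    have : Z 0 1 x y' j = Z 0 0 x y j := by
      rcases hj.lt_or_eq with h | rfl
      · simp only [Z, linkFunctional_left _ _ _ _ h]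
      · simp only [Z, linkFunctional_at]
    simp only [Θ, this]
  · intro j hj
    have : Z 0 1 x y' j = Z 1 1 x' y' j := by
      rcases (Nat.succ_le_of_lt hj).lt_or_eq with h | rfl
      · simp only [Z, linkFunctional_right _ _ _ _ h]
      · simp only [Z, linkFunctional_succ, Nat.succ_eq_add_one]
    simp only [Θ, this]
  · rw [hΘ, hzero 0 1 x y' 0 (by simp), hzero 0 1 x y' 1 (by simp)]
    ring

end
end

section
/- Let ι be a finite type and let ρ, P, Q be matrices in Matrix ι ι ℂ such that ρ is positive semidefinite with trace 1, P and Q are Hermitian idempotents (P² = P, Q² = Q, P† = P, Q† = Q), and P and Q commute. Then the traces tr(ρP), tr(ρQ), tr(ρPQ) are real and tr(ρPQ) ≥ tr(ρP) + tr(ρQ) − 1. -/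
open scoped ComplexOrder

/-- The trace of a positive semidefinite matrix against an orthogonal projection is nonnegative. -/
theorem Matrix.PosSemidef.trace_mul_nonneg_of_isStarProjection {ι : Type*} [Fintype ι]
    {ρ E : Matrix ι ι ℂ} (hρ : ρ.PosSemidef) (hE : IsStarProjection E) :
    0 ≤ (ρ * E).trace := by
  have h := (hρ.mul_mul_conjTranspose_same E).trace_nonneg
  rwa [← Matrix.star_eq_conjTranspose, hE.isSelfAdjoint.star_eq, Matrix.mul_assoc,
    Matrix.trace_mul_comm, Matrix.mul_assoc, hE.isIdempotentElem.eq] at h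

/-- **Fidelity lower bound.** If `ρ` is a density matrix (positive semidefinite, trace
one) and `P, Q` are commuting Hermitian idempotents (orthogonal projections), then
`tr(ρP)`, `tr(ρQ)`, `tr(ρPQ)` are real and `tr(ρPQ) ≥ tr(ρP) + tr(ρQ) − 1`. -/
theorem trace_projection_lower_bound {ι : Type*} [Fintype ι] [DecidableEq ι]
    (ρ P Q : Matrix ι ι ℂ)
    (hρ : ρ.PosSemidef) (hρtr : ρ.trace = 1)
    (hP2 : P * P = P) (hQ2 : Q * Q = Q)
    (hPh : P.conjTranspose = P) (hQh : Q.conjTranspose = Q)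
    (hPQ : P * Q = Q * P) :
    (ρ * P).trace.im = 0 ∧ (ρ * Q).trace.im = 0 ∧ (ρ * (P * Q)).trace.im = 0 ∧
    (ρ * P).trace.re + (ρ * Q).trace.re - 1 ≤ (ρ * (P * Q)).trace.re := by
  have hP : IsStarProjection P := ⟨hP2, hPh⟩
  have hQ : IsStarProjection Q := ⟨hQ2, hQh⟩
  have hP0 := Complex.nonneg_iff.mp (hρ.trace_mul_nonneg_of_isStarProjection hP)
  have hQ0 := Complex.nonneg_iff.mp (hρ.trace_mul_nonneg_of_isStarProjection hQ)
  have hPQ0 := Complex.nonneg_iff.mp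
    (hρ.trace_mul_nonneg_of_isStarProjection (hP.mul hQ hPQ))
  have hcomm : Commute (1 - P) (1 - Q) :=
    ((Commute.one_left _).sub_left ((Commute.one_right P).sub_right hPQ))
  have hK := (Complex.nonneg_iff.mp
    (hρ.trace_mul_nonneg_of_isStarProjection (hP.one_sub.mul hQ.one_sub hcomm))).1
  have hexp : ρ * ((1 - P) * (1 - Q)) = ρ - ρ * P - ρ * Q + ρ * (P * Q) := by
    noncomm_ring
  rw [hexp, Matrix.trace_add, Matrix.trace_sub, Matrix.trace_sub, hρtr] at hK
  simp only [Complex.add_re, Complex.sub_re, Complex.one_re] at hK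
  exact ⟨hP0.2.symm, hQ0.2.symm, hPQ0.2.symm, by linarith⟩
end
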